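/- arXiv:2012.13950 — 3 statements merged into one kernel-verified Lean document; each statement's English description precedes it below -/
import Mathlib

section
/- Let H be a nontrivial real Hilbert space, A : H → H a compact self-adjoint continuous linear operator that is positive definite (⟨A v, v⟩ > 0 for every v ≠ 0), and B : H → H a continuous self-adjoint linear operator that is coercive (there is c₀ > 0 with ⟨B v, v⟩ ≥ c₀ ‖v‖² for all v). Then the supremum τ₁ := sup { ⟨A v, v⟩ : v ∈ H, ⟨B v, v⟩ = 1 } is finite, strictly positive, and attained: there exists j₁ ∈ H with ⟨B j₁, j₁⟩ = 1 and ⟨A j₁, j₁⟩ = τ₁. -/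
open RealInnerProductSpace

/-- A symmetric positive semidefinite bounded operator satisfies `‖C v‖² ≤ (‖C‖ + 1) ⟨C v, v⟩`. -/
theorem ContinuousLinearMap.norm_apply_sq_le_of_symmetric_of_nonneg
    {H : Type*} [NormedAddCommGroup H] [InnerProductSpace ℝ H] (C : H →L[ℝ] H)
    (hC : ∀ x y : H, ⟪C x, y⟫ = ⟪x, C y⟫) (hC0 : ∀ v : H, 0 ≤ ⟪C v, v⟫) (v : H) :
    ‖C v‖ ^ 2 ≤ (‖C‖ + 1) * ⟪C v, v⟫ := by
  have hM : 0 < ‖C‖ + 1 := by positivity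
  have h1 : ⟪C (C v), C v⟫ ≤ (‖C‖ + 1) * ‖C v‖ ^ 2 := by
    have h2 := real_inner_le_norm (C (C v)) (C v)
    have h3 := mul_le_mul_of_nonneg_right (C.le_opNorm (C v)) (norm_nonneg (C v))
    nlinarith [sq_nonneg ‖C v‖]
  have h := hC0 ((‖C‖ + 1) • v - C v)
  simp only [map_sub, map_smul, inner_sub_left, inner_sub_right, real_inner_smul_left,
    real_inner_smul_right] at h
  rw [hC (C v) v, real_inner_self_eq_norm_sq] at h
  have h4 : 0 ≤ (‖C‖ + 1) * ((‖C‖ + 1) * ⟪C v, v⟫ - ‖C v‖ ^ 2) := by linarith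
  linarith [nonneg_of_mul_nonneg_right h4 hM]

/-- A coercive bounded operator on a Hilbert space is a closed embedding. -/
theorem ContinuousLinearMap.isClosedEmbedding_of_coercive
    {H : Type*} [NormedAddCommGroup H] [InnerProductSpace ℝ H] [CompleteSpace H]
    (B : H →L[ℝ] H) {c : ℝ} (hc : 0 < c) (hB : ∀ v : H, c * ‖v‖ ^ 2 ≤ ⟪B v, v⟫) :
    Topology.IsClosedEmbedding B := by
  have hbound (v : H) : ‖v‖ ≤ (⟨c⁻¹, by positivity⟩ : NNReal) * ‖B v‖ := by
    change ‖v‖ ≤ c⁻¹ * ‖B v‖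
    rw [inv_mul_eq_div, le_div_iff₀ hc]
    rcases (norm_nonneg v).eq_or_lt with h | h
    · rw [← h, zero_mul]
      positivity
    · refine le_of_mul_le_mul_right ?_ h
      linarith [hB v, real_inner_le_norm (B v) v]
  exact (B.antilipschitz_of_bound hbound).isClosedEmbedding B.uniformContinuous

/-- Proposition 3.2 (i)–(iii). The supremum
`τ₁ = sup { ⟨A v, v⟩ : ⟨B v, v⟩ = 1 }` is finite, strictly positive, and attained. -/
theorem first_eigenvalue_attained
    {H : Type*} [NormedAddCommGroup H] [InnerProductSpace ℝ H] [CompleteSpace H]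
    [Nontrivial H]
    (A : H →L[ℝ] H) (hA_cpt : IsCompactOperator A)
    (hA_sa : ∀ x y : H, ⟪A x, y⟫ = ⟪x, A y⟫)
    (hA_pos : ∀ v : H, v ≠ 0 → 0 < ⟪A v, v⟫)
    (B : H →L[ℝ] H)
    (hB_sa : ∀ x y : H, ⟪B x, y⟫ = ⟪x, B y⟫)
    (hB_coer : ∃ c₀ : ℝ, 0 < c₀ ∧ ∀ v : H, c₀ * ‖v‖ ^ 2 ≤ ⟪B v, v⟫) :
    BddAbove {x : ℝ | ∃ v : H, ⟪B v, v⟫ = 1 ∧ x = ⟪A v, v⟫} ∧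
    0 < sSup {x : ℝ | ∃ v : H, ⟪B v, v⟫ = 1 ∧ x = ⟪A v, v⟫} ∧
    ∃ j₁ : H, ⟪B j₁, j₁⟫ = 1 ∧
      ⟪A j₁, j₁⟫ = sSup {x : ℝ | ∃ v : H, ⟪B v, v⟫ = 1 ∧ x = ⟪A v, v⟫} := by
  obtain ⟨c, hc, hB⟩ := hB_coer
  set S : Set ℝ := {x : ℝ | ∃ v : H, ⟪B v, v⟫ = 1 ∧ x = ⟪A v, v⟫}
  have hBpos (v : H) (hv : v ≠ 0) : 0 < ⟪B v, v⟫ :=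
    lt_of_lt_of_le (by positivity) (hB v)
  have hnorm (v : H) (hv : ⟪B v, v⟫ = 1) : ‖v‖ ^ 2 ≤ c⁻¹ := by
    rw [← one_div, le_div_iff₀ hc, mul_comm]
    exact hv ▸ hB v
  have hbdd : BddAbove S := by
    refine ⟨‖A‖ * c⁻¹, ?_⟩
    rintro _ ⟨v, hv, rfl⟩
    calc ⟪A v, v⟫ ≤ ‖A v‖ * ‖v‖ := real_inner_le_norm _ _
      _ ≤ ‖A‖ * ‖v‖ * ‖v‖ := by gcongr; exact A.le_opNorm v
      _ = ‖A‖ * ‖v‖ ^ 2 := by ring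
      _ ≤ ‖A‖ * c⁻¹ := by gcongr; exact hnorm v hv
  have hray (v : H) : ⟪A v, v⟫ ≤ sSup S * ⟪B v, v⟫ := by
    rcases eq_or_ne v 0 with rfl | hv
    · simp
    have hb := hBpos v hv
    have hsq := Real.mul_self_sqrt hb.le
    have hs : Real.sqrt ⟪B v, v⟫ ≠ 0 := (Real.sqrt_pos.2 hb).ne'
    rw [← div_le_iff₀ hb]
    refine le_csSup hbdd ⟨(Real.sqrt ⟪B v, v⟫)⁻¹ • v, ?_, ?_⟩
    · simp only [map_smul, real_inner_smul_left, real_inner_smul_right]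
      rw [← mul_assoc, ← mul_inv, hsq, inv_mul_cancel₀ hb.ne']
    · simp only [map_smul, real_inner_smul_left, real_inner_smul_right]
      rw [← mul_assoc, ← mul_inv, hsq, inv_mul_eq_div]
  obtain ⟨e, he⟩ := exists_ne (0 : H)
  have hpos : 0 < sSup S :=
    pos_of_mul_pos_left ((hA_pos e he).trans_le (hray e)) (hBpos e he).le
  have hne : S.Nonempty := by
    by_contra h
    rw [Set.not_nonempty_iff_eq_empty.1 h, Real.sSup_empty] at hpos
    exact hpos.false
  refine ⟨hbdd, hpos, ?_⟩
  obtain ⟨u, -, hu, huS⟩ := exists_seq_tendsto_sSup hne hbdd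
  choose v hv huv using huS
  obtain rfl : u = fun n => ⟪A (v n), v n⟫ := funext huv
  obtain ⟨w, -, φ, hφ, hw⟩ := (hA_cpt.isCompact_closure_image_closedBall
      (Real.sqrt c⁻¹)).tendsto_subseq (x := fun n => A (v n)) fun n =>
    subset_closure ⟨v n, by simpa using Real.le_sqrt_of_sq_le (hnorm _ (hv n)), rfl⟩
  -- The nonnegative operator `τ₁ B - A` tends to zero along the maximizing sequence.
  have hC (n : ℕ) : ‖sSup S • B (v n) - A (v n)‖ ^ 2 ≤
      (‖sSup S • B - A‖ + 1) * (sSup S - ⟪A (v n), v n⟫) := by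
    have h := (sSup S • B - A).norm_apply_sq_le_of_symmetric_of_nonneg
      (fun x y => by
        simp [inner_sub_left, inner_sub_right, real_inner_smul_left, real_inner_smul_right,
          hA_sa, hB_sa])
      (fun x => by
        simpa [inner_sub_left, real_inner_smul_left] using hray x) (v n)
    simpa [inner_sub_left, real_inner_smul_left, hv] using h
  have hC0 : Filter.Tendsto (fun n => sSup S • B (v n) - A (v n)) Filter.atTop (nhds 0) := by
    refine squeeze_zero_norm (fun n => Real.le_sqrt_of_sq_le (hC n)) ?_
    simpa using ((hu.const_sub (sSup S)).const_mul (‖sSup S • B - A‖ + 1)).sqrt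
  have hBv : Filter.Tendsto (fun n => B (v (φ n))) Filter.atTop (nhds ((sSup S)⁻¹ • w)) := by
    have h := ((hC0.comp hφ.tendsto_atTop).add hw).const_smul (sSup S)⁻¹
    simpa [Function.comp_def, smul_smul, inv_mul_cancel₀ hpos.ne'] using h
  have hemb := B.isClosedEmbedding_of_coercive hc hB
  obtain ⟨j, hj⟩ := hemb.isClosed_range.mem_of_tendsto hBv
    (Filter.Eventually.of_forall fun n => ⟨v (φ n), rfl⟩)
  have hvj : Filter.Tendsto (fun n => v (φ n)) Filter.atTop (nhds j) :=
    hemb.isEmbedding.tendsto_nhds_iff.2 (hj ▸ hBv)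
  refine ⟨j, ?_, ?_⟩
  · refine tendsto_nhds_unique (((B.continuous.tendsto j).comp hvj).inner hvj) ?_
    simp [hv]
  · exact tendsto_nhds_unique (((A.continuous.tendsto j).comp hvj).inner hvj)
      (hu.comp hφ.tendsto_atTop)
end

section
/- Let H be an infinite-dimensional real Hilbert space, A : H → H a compact self-adjoint positive definite continuous linear operator, and B : H → H a continuous self-adjoint coercive linear operator. Let (j_n)_{n≥1} in H and (τ_n)_{n≥1} in ℝ satisfy: ⟨B j_n, j_m⟩ = δ_{nm}; for every n, τ_n = sup { ⟨A v, v⟩ : v ∈ H, ⟨B v, v⟩ = 1, ⟨B v, j_m⟩ = 0 for all m < n }; and τ_n → 0 as n → ∞. Then the linear span of { j_n : n ≥ 1 } is dense in H (equivalently, the only v ∈ H with ⟨B v, j_n⟩ = 0 for every n is v = 0). -/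
open RealInnerProductSpace

/-- A coercive continuous linear operator on a real Hilbert space is surjective (Lax–Milgram). -/
theorem ContinuousLinearMap.surjective_of_inner_coercive
    {H : Type*} [NormedAddCommGroup H] [InnerProductSpace ℝ H] [CompleteSpace H]
    (B : H →L[ℝ] H) {c : ℝ} (hc : 0 < c) (hB : ∀ v : H, c * ‖v‖ ^ 2 ≤ ⟪B v, v⟫) :
    Function.Surjective B := by
  have hco : IsCoercive ((innerSL ℝ).comp B : H →L[ℝ] H →L[ℝ] ℝ) :=
    ⟨c, hc, fun v => by simpa [sq, mul_assoc] using hB v⟩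
  intro u
  obtain ⟨v, rfl⟩ := hco.continuousLinearEquivOfBilin.surjective u
  refine ⟨v, ext_inner_right ℝ fun w => ?_⟩
  rw [hco.continuousLinearEquivOfBilin_apply]
  simp

/-- The quadratic form of a continuous linear operator is bounded by a multiple of any coercive
quadratic form. -/
theorem ContinuousLinearMap.inner_apply_self_le_of_coercive
    {H : Type*} [NormedAddCommGroup H] [InnerProductSpace ℝ H]
    (A B : H →L[ℝ] H) {c : ℝ} (hc : 0 < c) (hB : ∀ v : H, c * ‖v‖ ^ 2 ≤ ⟪B v, v⟫) (v : H) :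
    ⟪A v, v⟫ ≤ ‖A‖ / c * ⟪B v, v⟫ :=
  calc ⟪A v, v⟫ ≤ ‖A v‖ * ‖v‖ := real_inner_le_norm _ _
    _ ≤ ‖A‖ * ‖v‖ * ‖v‖ := by gcongr; exact A.le_opNorm v
    _ = ‖A‖ / c * (c * ‖v‖ ^ 2) := by field_simp
    _ ≤ ‖A‖ / c * ⟪B v, v⟫ := by gcongr; exact hB v

/-- Proposition 3.6. The sequence of maximizers of the recursive
variational problem forms a complete basis of `H`: its linear span is dense. -/
theorem eigenvectors_complete_basis
    {H : Type*} [NormedAddCommGroup H] [InnerProductSpace ℝ H] [CompleteSpace H]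
    (hH_inf : ¬ FiniteDimensional ℝ H)
    (A : H →L[ℝ] H) (hA_cpt : IsCompactOperator A)
    (hA_sa : ∀ x y : H, ⟪A x, y⟫ = ⟪x, A y⟫)
    (hA_pos : ∀ v : H, v ≠ 0 → 0 < ⟪A v, v⟫)
    (B : H →L[ℝ] H)
    (hB_sa : ∀ x y : H, ⟪B x, y⟫ = ⟪x, B y⟫)
    (hB_coer : ∃ c₀ : ℝ, 0 < c₀ ∧ ∀ v : H, c₀ * ‖v‖ ^ 2 ≤ ⟪B v, v⟫)
    (j : ℕ → H) (τ : ℕ → ℝ)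
    (hj_orth : ∀ n m : ℕ, ⟪B (j n), j m⟫ = if n = m then 1 else 0)
    (hτ_sup : ∀ n : ℕ, τ n = sSup {x : ℝ | ∃ v : H, ⟪B v, v⟫ = 1 ∧
        (∀ m : ℕ, m < n → ⟪B v, j m⟫ = 0) ∧ x = ⟪A v, v⟫})
    (hτ_lim : Filter.Tendsto τ Filter.atTop (nhds 0)) :
    Dense (Submodule.span ℝ (Set.range j) : Set H) := by
  obtain ⟨c, hc, hB⟩ := hB_coer
  have key : ∀ v : H, (∀ n, ⟪B v, j n⟫ = 0) → v = 0 := by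
    intro v hv
    by_contra hv0
    have hBv : 0 < ⟪B v, v⟫ :=
      lt_of_lt_of_le (mul_pos hc (pow_pos (norm_pos_iff.2 hv0) 2)) (hB v)
    have hsq : √⟪B v, v⟫ * √⟪B v, v⟫ = ⟪B v, v⟫ := Real.mul_self_sqrt hBv.le
    have hs : 0 < √⟪B v, v⟫ := Real.sqrt_pos.2 hBv
    set s := √⟪B v, v⟫
    set w : H := s⁻¹ • v with hw
    have hBw : ⟪B w, w⟫ = 1 := by
      rw [hw, map_smul, real_inner_smul_left, real_inner_smul_right, ← hsq]
      field_simp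
    have hAw : 0 < ⟪A w, w⟫ := hA_pos w (smul_ne_zero (inv_ne_zero hs.ne') hv0)
    have hle : ∀ n, ⟪A w, w⟫ ≤ τ n := by
      intro n
      rw [hτ_sup n]
      refine le_csSup ⟨‖A‖ / c, ?_⟩ ⟨w, hBw, fun m _ => ?_, rfl⟩
      · rintro _ ⟨x, hx, -, rfl⟩
        simpa [hx] using A.inner_apply_self_le_of_coercive B hc hB x
      · rw [hw, map_smul, real_inner_smul_left, hv m, mul_zero]
    exact absurd (ge_of_tendsto' hτ_lim hle) (not_le.2 hAw)
  rw [Submodule.dense_iff_topologicalClosure_eq_top, Submodule.topologicalClosure_eq_top_iff,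
    Submodule.eq_bot_iff]
  intro u hu
  obtain ⟨v, rfl⟩ := B.surjective_of_inner_coercive hc hB u
  rw [key v fun n => (Submodule.mem_orthogonal' _ _).1 hu _
    (Submodule.subset_span ⟨n, rfl⟩), map_zero]
end

section
/- Let H be a real Hilbert space, A : H → H a compact self-adjoint positive definite continuous linear operator, and B : H → H a continuous self-adjoint coercive linear operator. Let (j_k)_{k≥1} in H and a nonincreasing positive sequence (τ_k)_{k≥1} with τ_k → 0 satisfy: ⟨B j_i, j_m⟩ = δ_{im}, ⟨A j_i, j_m⟩ = τ_i δ_{im} for all i, m, and the span of { j_k : k ≥ 1 } is dense in H. Then for every n ≥ 1, τ_n = max over all n-dimensional linear subspaces U of H of ( inf over nonzero v ∈ U of ⟨A v, v⟩ / ⟨B v, v⟩ ), and the maximum is attained at U = span{ j₁, …, j_n }. -/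
open RealInnerProductSpace

section

variable {H : Type*} [NormedAddCommGroup H] [InnerProductSpace ℝ H]

/-- A quadratic form that is diagonal with nonnegative entries on a family is nonnegative on its
span. -/
theorem inner_self_nonneg_of_mem_span_image (M : H →L[ℝ] H) (j : ℕ → H) (d : ℕ → ℝ)
    (hM : ∀ i m : ℕ, ⟪M (j i), j m⟫ = if i = m then d i else 0)
    (S : Set ℕ) (hd : ∀ i ∈ S, 0 ≤ d i) {v : H} (hv : v ∈ Submodule.span ℝ (j '' S)) :
    0 ≤ ⟪M v, v⟫ := by
  obtain ⟨l, hl, rfl⟩ := (Finsupp.mem_span_image_iff_linearCombination ℝ).1 hv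
  have hsum : ⟪M (Finsupp.linearCombination ℝ j l), Finsupp.linearCombination ℝ j l⟫
      = ∑ i ∈ l.support, l i * (l i * d i) := by
    simp only [Finsupp.linearCombination_apply, Finsupp.sum, map_sum, map_smul, sum_inner,
      inner_sum, inner_smul_left, inner_smul_right, hM]
    refine Finset.sum_congr rfl fun i hi => ?_
    simp +contextual
  rw [hsum]
  refine Finset.sum_nonneg fun i hi => ?_
  have := hd i ((Finsupp.mem_supported ℝ l).1 hl hi)
  nlinarith [mul_nonneg (mul_self_nonneg (l i)) this]

theorem linearIndependent_of_inner_eq_ite (B : H →L[ℝ] H) (j : ℕ → H)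
    (hB : ∀ i m : ℕ, ⟪B (j i), j m⟫ = if i = m then 1 else 0) :
    LinearIndependent ℝ j := by
  rw [linearIndependent_iff']
  intro s g hg i hi
  have h : ⟪B (∑ k ∈ s, g k • j k), j i⟫ = g i := by
    simp [map_sum, sum_inner, inner_smul_left, hB, hi]
  rw [← h, hg]
  simp

theorem finrank_span_image_Iic {j : ℕ → H} (hj : LinearIndependent ℝ j) (n : ℕ) :
    Module.finrank ℝ (Submodule.span ℝ (j '' Set.Iic n)) = n + 1 := by
  have hli : LinearIndependent ℝ fun i : Set.Iic n => j i :=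
    hj.comp _ Subtype.val_injective
  have h := finrank_span_eq_card hli
  rw [Set.image_eq_range, h]
  simp

/-- On the `B`-orthogonal complement of the first `n` modes, the form of `A` is bounded by
`τ n` times the form of `B`. -/
theorem inner_le_mul_inner_of_orthogonal (A B : H →L[ℝ] H) (j : ℕ → H) (τ : ℕ → ℝ)
    (hτ_anti : Antitone τ)
    (hB : ∀ i m : ℕ, ⟪B (j i), j m⟫ = if i = m then 1 else 0)
    (hA : ∀ i m : ℕ, ⟪A (j i), j m⟫ = if i = m then τ i else 0)
    (hj_dense : Dense (Submodule.span ℝ (Set.range j) : Set H))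
    (n : ℕ) {v : H} (hv : ∀ i < n, ⟪B v, j i⟫ = 0) :
    ⟪A v, v⟫ ≤ τ n * ⟪B v, v⟫ := by
  let M : H →L[ℝ] H := τ n • B - A
  have hM : ∀ i m : ℕ, ⟪M (j i), j m⟫ = if i = m then τ n - τ i else 0 := by
    intro i m
    simp only [M, sub_apply, smul_apply, inner_sub_left,
      real_inner_smul_left, hA, hB]
    split_ifs <;> simp
  let P : H →ₗ[ℝ] H := LinearMap.id -
    ∑ i ∈ Finset.range n, ((innerₗ H (j i)).comp B.toLinearMap).smulRight (j i)
  have hP : ∀ w, P w = w - ∑ i ∈ Finset.range n, ⟪B w, j i⟫ • j i := by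
    intro w
    simp [P, real_inner_comm]
  have hPcont : Continuous P := by
    rw [show (P : H → H) = _ from funext hP]
    fun_prop
  have hPj : ∀ k, P (j k) ∈ Submodule.span ℝ (j '' Set.Ici n) := by
    intro k
    rw [hP]
    simp only [hB, ite_smul, one_smul, zero_smul, Finset.sum_ite_eq, Finset.mem_range]
    split_ifs with hk
    · simp
    · simpa using Submodule.subset_span (Set.mem_image_of_mem j (Set.mem_Ici.2 (not_lt.1 hk)))
  have hspan : ∀ w ∈ Submodule.span ℝ (Set.range j), P w ∈ Submodule.span ℝ (j '' Set.Ici n) := by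
    intro w hw
    have : Submodule.span ℝ (Set.range j) ≤ (Submodule.span ℝ (j '' Set.Ici n)).comap P :=
      Submodule.span_le.2 (by rintro _ ⟨k, rfl⟩; exact hPj k)
    exact this hw
  have hclosed : IsClosed {w : H | 0 ≤ ⟪M (P w), P w⟫} :=
    isClosed_le continuous_const ((M.continuous.comp hPcont).inner hPcont)
  have hsub : (Submodule.span ℝ (Set.range j) : Set H) ⊆ {w : H | 0 ≤ ⟪M (P w), P w⟫} :=
    fun w hw => inner_self_nonneg_of_mem_span_image M j _ hM (Set.Ici n)
      (fun _ hi => sub_nonneg.2 (hτ_anti hi)) (hspan w hw)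
  have hmem : 0 ≤ ⟪M (P v), P v⟫ := closure_minimal hsub hclosed (hj_dense v)
  have hPv : P v = v := by
    rw [hP, Finset.sum_eq_zero, sub_zero]
    intro i hi
    rw [hv i (Finset.mem_range.1 hi), zero_smul]
  rw [hPv] at hmem
  simpa [M, inner_sub_left, real_inner_smul_left] using hmem

/-- A subspace of dimension `n + 1` contains a nonzero vector that is `B`-orthogonal to any `n`
given vectors. -/
theorem exists_ne_zero_inner_eq_zero (B : H →L[ℝ] H) (j : ℕ → H) (n : ℕ) (U : Submodule ℝ H)
    (hU : Module.finrank ℝ U = n + 1) :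
    ∃ v ∈ U, v ≠ 0 ∧ ∀ i < n, ⟪B v, j i⟫ = 0 := by
  have : FiniteDimensional ℝ U := Module.finite_of_finrank_pos (by omega)
  let f : U →ₗ[ℝ] (Fin n → ℝ) :=
    LinearMap.pi fun i => (innerₗ H (j i)).comp (B.toLinearMap.comp U.subtype)
  have hf : LinearMap.ker f ≠ ⊥ := LinearMap.ker_ne_bot_of_finrank_lt (by simp [hU])
  obtain ⟨u, hu, hu0⟩ := Submodule.exists_mem_ne_zero_of_ne_bot hf
  refine ⟨u, u.2, by simpa using hu0, fun i hi => ?_⟩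
  have := congrFun (LinearMap.mem_ker.1 hu) ⟨i, hi⟩
  rw [real_inner_comm]
  simpa [f] using this

end

/-- Lemma 4.2. Max–min (Courant–Fischer type) characterization of
the generalized eigenvalues: `τ_n` is the maximum, over all `(n+1)`-dimensional
subspaces `U` of `H`, of the infimum of the Rayleigh quotient over nonzero `v ∈ U`,
and the maximum is attained at the span of the first `n+1` eigenvectors.
(Sequences are indexed from `0`, so `j 0, …, j n` are the first `n+1` modes.) -/
theorem maxmin_characterization
    {H : Type*} [NormedAddCommGroup H] [InnerProductSpace ℝ H] [CompleteSpace H]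
    (A : H →L[ℝ] H) (hA_cpt : IsCompactOperator A)
    (hA_sa : ∀ x y : H, ⟪A x, y⟫ = ⟪x, A y⟫)
    (hA_pos : ∀ v : H, v ≠ 0 → 0 < ⟪A v, v⟫)
    (B : H →L[ℝ] H)
    (hB_sa : ∀ x y : H, ⟪B x, y⟫ = ⟪x, B y⟫)
    (hB_coer : ∃ c₀ : ℝ, 0 < c₀ ∧ ∀ v : H, c₀ * ‖v‖ ^ 2 ≤ ⟪B v, v⟫)
    (j : ℕ → H) (τ : ℕ → ℝ)
    (hτ_anti : Antitone τ) (hτ_pos : ∀ k : ℕ, 0 < τ k)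
    (hτ_lim : Filter.Tendsto τ Filter.atTop (nhds 0))
    (hj_Borth : ∀ i m : ℕ, ⟪B (j i), j m⟫ = if i = m then 1 else 0)
    (hj_Aorth : ∀ i m : ℕ, ⟪A (j i), j m⟫ = if i = m then τ i else 0)
    (hj_dense : Dense (Submodule.span ℝ (Set.range j) : Set H)) :
    ∀ n : ℕ,
      IsGreatest {x : ℝ | ∃ U : Submodule ℝ H, Module.finrank ℝ U = n + 1 ∧
          x = sInf {y : ℝ | ∃ v ∈ U, v ≠ 0 ∧ y = ⟪A v, v⟫ / ⟪B v, v⟫}} (τ n) ∧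
      sInf {y : ℝ | ∃ v ∈ Submodule.span ℝ (j '' Set.Iic n), v ≠ 0 ∧
          y = ⟪A v, v⟫ / ⟪B v, v⟫} = τ n := by
  obtain ⟨c₀, hc₀, hcoer⟩ := hB_coer
  have hB_pos : ∀ v : H, v ≠ 0 → 0 < ⟪B v, v⟫ := fun v hv =>
    (mul_pos hc₀ (pow_pos (norm_pos_iff.2 hv) 2)).trans_le (hcoer v)
  intro n
  have hspan : sInf {y : ℝ | ∃ v ∈ Submodule.span ℝ (j '' Set.Iic n), v ≠ 0 ∧
      y = ⟪A v, v⟫ / ⟪B v, v⟫} = τ n := by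
    refine IsLeast.csInf_eq ⟨⟨j n, Submodule.subset_span ⟨n, Set.mem_Iic.2 le_rfl, rfl⟩, ?_, ?_⟩, ?_⟩
    · intro h
      simpa [h] using hj_Borth n n
    · simp [hj_Aorth, hj_Borth]
    · rintro _ ⟨v, hv, hv0, rfl⟩
      rw [le_div_iff₀ (hB_pos v hv0)]
      have h := inner_self_nonneg_of_mem_span_image (A - τ n • B) j (fun i => τ i - τ n)
        (fun i m => by
          simp only [sub_apply, smul_apply,
            inner_sub_left, real_inner_smul_left, hj_Aorth, hj_Borth]
          split_ifs <;> simp)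
        (Set.Iic n) (fun _ hi => sub_nonneg.2 (hτ_anti hi)) hv
      simpa [inner_sub_left, real_inner_smul_left] using h
  refine ⟨⟨⟨_, finrank_span_image_Iic (linearIndependent_of_inner_eq_ite B j hj_Borth) n,
    hspan.symm⟩, ?_⟩, hspan⟩
  rintro _ ⟨U, hU, rfl⟩
  obtain ⟨v, hvU, hv0, hv⟩ := exists_ne_zero_inner_eq_zero B j n U hU
  have hbdd : BddBelow {y : ℝ | ∃ v ∈ U, v ≠ 0 ∧ y = ⟪A v, v⟫ / ⟪B v, v⟫} := by
    refine ⟨0, ?_⟩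
    rintro _ ⟨w, -, hw0, rfl⟩
    exact (div_pos (hA_pos w hw0) (hB_pos w hw0)).le
  refine (csInf_le hbdd ⟨v, hvU, hv0, rfl⟩).trans ?_
  rw [div_le_iff₀ (hB_pos v hv0)]
  exact inner_le_mul_inner_of_orthogonal A B j τ hτ_anti hj_Borth hj_Aorth hj_dense n hv
end
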